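/- arXiv:2212.00781 — 3 statements merged into one kernel-verified Lean document; each statement's English description precedes it below -/
import Mathlib

section
/- Let m ≥ 1, M := 6·m·L, and suppose f is bounded below: f(y) ≥ f⋆ for all y ∈ E. Let x_0, x_1, … be iterates such that for every k ≥ 0, x_{k+1} is a lazy cubic Newton step T_M(x_k, x_{π(k)}), where π(k) := k − (k mod m). Then for any k = t·m with t ≥ 1, there exists an index 1 ≤ i ≤ k such that for all h ∈ E: ⟨∇²f(x_i) h, h⟩ ≥ −( 648·M²·(f(x_0) − f⋆)/k )^{1/3} · ‖h‖². -/
open scoped InnerProductSpace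

/-- A function whose gradient `g` has an `L`-Lipschitz derivative `H` lies below its second-order
Taylor polynomial plus a cubic term. -/
theorem le_taylor_add_cubic_of_lipschitz_hessian
    {E : Type*} [NormedAddCommGroup E] [InnerProductSpace ℝ E] [CompleteSpace E]
    {f : E → ℝ} {g : E → E} {H : E → E →L[ℝ] E} {L : ℝ} (hL : 0 ≤ L)
    (hg : ∀ y, HasGradientAt f (g y) y) (hH : ∀ y, HasFDerivAt g (H y) y)
    (hLip : ∀ y₁ y₂, ‖H y₁ - H y₂‖ ≤ L * ‖y₁ - y₂‖) (x d : E) :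
    f (x + d) ≤ f x + ⟪g x, d⟫_ℝ + ⟪H x d, d⟫_ℝ / 2 + L / 3 * ‖d‖ ^ 3 := by
  have grad_bound : ∀ y, ‖g y - g x - H x (y - x)‖ ≤ L * ‖y - x‖ * ‖y - x‖ := by
    intro y
    refine (convex_closedBall x ‖y - x‖).norm_image_sub_le_of_norm_hasFDerivWithin_le'
      (fun z _ => (hH z).hasFDerivWithinAt) (fun z hz => ?_) (Metric.mem_closedBall_self
      (norm_nonneg _)) (by simp [dist_eq_norm])
    refine (hLip z x).trans (mul_le_mul_of_nonneg_left ?_ hL)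
    simpa [dist_eq_norm] using hz
  let φ : ℝ → ℝ := fun s =>
    f (x + s • d) - s * ⟪g x, d⟫_ℝ - s ^ 2 * (⟪H x d, d⟫_ℝ / 2) - s ^ 3 * (L / 3 * ‖d‖ ^ 3)
  have hφ : ∀ s, HasDerivAt φ (⟪g (x + s • d), d⟫_ℝ - 1 * ⟪g x, d⟫_ℝ
      - (2 * s) * (⟪H x d, d⟫_ℝ / 2) - (3 * s ^ 2) * (L / 3 * ‖d‖ ^ 3)) s := by
    intro s
    have line : HasDerivAt (fun s : ℝ => x + s • d) d s := by
      simpa using ((hasDerivAt_id s).smul_const d).const_add x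
    have h₁ : HasDerivAt (fun s : ℝ => f (x + s • d)) ⟪g (x + s • d), d⟫_ℝ s := by
      simpa [Function.comp_def] using (hg (x + s • d)).hasFDerivAt.comp_hasDerivAt s line
    have h₂ : HasDerivAt (fun s : ℝ => s ^ 2) (2 * s) s := by
      simpa using hasDerivAt_pow 2 s
    have h₃ : HasDerivAt (fun s : ℝ => s ^ 3) (3 * s ^ 2) s := by
      simpa using hasDerivAt_pow 3 s
    exact ((h₁.sub ((hasDerivAt_id s).mul_const _)).sub (h₂.mul_const _)).sub (h₃.mul_const _)
  have anti : AntitoneOn φ (Set.Icc 0 1) := by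
    refine antitoneOn_of_deriv_nonpos (convex_Icc 0 1)
      (fun s _ => (hφ s).continuousAt.continuousWithinAt)
      (fun s _ => (hφ s).differentiableAt.differentiableWithinAt) (fun s hs => ?_)
    rw [interior_Icc] at hs
    rw [(hφ s).deriv]
    have h₁ := real_inner_le_norm (g (x + s • d) - g x - H x (s • d)) d
    have h₂ := grad_bound (x + s • d)
    rw [add_sub_cancel_left, norm_smul, Real.norm_of_nonneg hs.1.le] at h₂
    have h₃ := mul_le_mul_of_nonneg_right h₂ (norm_nonneg d)
    rw [map_smul, inner_sub_left, inner_sub_left, real_inner_smul_left] at h₁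
    rw [map_smul] at h₃
    linarith
  have h := anti (Set.left_mem_Icc.2 zero_le_one) (Set.right_mem_Icc.2 zero_le_one) zero_le_one
  simp only [φ, one_smul, zero_smul, add_zero] at h
  linarith

/-- Decrease of the objective along a cubic Newton step whose Hessian is evaluated at a stale
point `z`. -/
theorem lazy_cubic_step_decrease
    {E : Type*} [NormedAddCommGroup E] [InnerProductSpace ℝ E] [CompleteSpace E]
    {f : E → ℝ} {g : E → E} {H : E → E →L[ℝ] E} {L M : ℝ} (hL : 0 ≤ L)
    (hg : ∀ y, HasGradientAt f (g y) y) (hH : ∀ y, HasFDerivAt g (H y) y)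
    (hLip : ∀ y₁ y₂, ‖H y₁ - H y₂‖ ≤ L * ‖y₁ - y₂‖) {x z y : E}
    (hstep : g x + H z (y - x) + (M * ‖y - x‖ / 2) • (y - x) = 0)
    (hpsd : ∀ h, 0 ≤ ⟪H z h, h⟫_ℝ + M * ‖y - x‖ / 2 * ‖h‖ ^ 2) :
    M / 4 * ‖y - x‖ ^ 3 - L / 2 * ‖x - z‖ * ‖y - x‖ ^ 2 - L / 3 * ‖y - x‖ ^ 3 ≤ f x - f y := by
  have taylor := le_taylor_add_cubic_of_lipschitz_hessian hL hg hH hLip x (y - x)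
  rw [add_sub_cancel] at taylor
  have stationary : ⟪g x, y - x⟫_ℝ + ⟪H z (y - x), y - x⟫_ℝ
      + M * ‖y - x‖ / 2 * ‖y - x‖ ^ 2 = 0 := by
    rw [← real_inner_self_eq_norm_sq, ← real_inner_smul_left, ← inner_add_left, ← inner_add_left,
      hstep, inner_zero_left]
  have curvature := hpsd (y - x)
  have change : ⟪H x (y - x), y - x⟫_ℝ - ⟪H z (y - x), y - x⟫_ℝ
      ≤ L * ‖x - z‖ * ‖y - x‖ ^ 2 := by
    rw [← inner_sub_left, ← sub_apply]
    calc ⟪(H x - H z) (y - x), y - x⟫_ℝ ≤ ‖(H x - H z) (y - x)‖ * ‖y - x‖ := real_inner_le_norm _ _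
      _ ≤ (‖H x - H z‖ * ‖y - x‖) * ‖y - x‖ := by gcongr; exact ContinuousLinearMap.le_opNorm _ _
      _ ≤ (L * ‖x - z‖ * ‖y - x‖) * ‖y - x‖ := by gcongr; exact hLip _ _
      _ = _ := by ring
  linarith

/-- Lower curvature bound at the point `y` reached by a cubic Newton step from `x` whose Hessian is
evaluated at a stale point `z`. -/
theorem lazy_cubic_step_curvature
    {E : Type*} [NormedAddCommGroup E] [InnerProductSpace ℝ E]
    {H : E → E →L[ℝ] E} {L M r : ℝ}
    (hLip : ∀ y₁ y₂, ‖H y₁ - H y₂‖ ≤ L * ‖y₁ - y₂‖) {z y : E}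
    (hpsd : ∀ h, 0 ≤ ⟪H z h, h⟫_ℝ + M * r / 2 * ‖h‖ ^ 2) (h : E) :
    -(M * r / 2 + L * ‖y - z‖) * ‖h‖ ^ 2 ≤ ⟪H y h, h⟫_ℝ := by
  have change : ⟪H z h, h⟫_ℝ - ⟪H y h, h⟫_ℝ ≤ L * ‖y - z‖ * ‖h‖ ^ 2 := by
    rw [← inner_sub_left, ← sub_apply]
    calc ⟪(H z - H y) h, h⟫_ℝ ≤ ‖(H z - H y) h‖ * ‖h‖ := real_inner_le_norm _ _
      _ ≤ (‖H z - H y‖ * ‖h‖) * ‖h‖ := by gcongr; exact ContinuousLinearMap.le_opNorm _ _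
      _ ≤ (L * ‖z - y‖ * ‖h‖) * ‖h‖ := by gcongr; exact hLip _ _
      _ = _ := by rw [norm_sub_rev]; ring
  linarith [hpsd h]

theorem norm_sub_le_sum_range_norm_sub {E : Type*} [SeminormedAddCommGroup E] (u : ℕ → E)
    {j m : ℕ} (hj : j ≤ m) : ‖u j - u 0‖ ≤ ∑ i ∈ Finset.range m, ‖u (i + 1) - u i‖ := by
  rw [← Finset.sum_range_sub]
  exact (norm_sum_le _ _).trans (Finset.sum_le_sum_of_subset_of_nonneg
    (Finset.range_mono hj) fun _ _ _ => norm_nonneg _)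

/-- If every iterate of one phase of length `m` has curvature below `-c` in some direction, then the
objective decreases by more than a multiple of `m * c ^ 3` during that phase. -/
theorem lazy_cubic_phase_decrease
    {E : Type*} [NormedAddCommGroup E] [InnerProductSpace ℝ E] [CompleteSpace E]
    {f : E → ℝ} {g : E → E} {H : E → E →L[ℝ] E} {L M c : ℝ} (hL : 0 < L)
    (hg : ∀ y, HasGradientAt f (g y) y) (hH : ∀ y, HasFDerivAt g (H y) y)
    (hLip : ∀ y₁ y₂, ‖H y₁ - H y₂‖ ≤ L * ‖y₁ - y₂‖)
    {m : ℕ} (hm : 1 ≤ m) (hM : M = 6 * (m : ℝ) * L) (u : ℕ → E)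
    (hstep : ∀ j < m, g (u j) + H (u 0) (u (j + 1) - u j)
      + (M * ‖u (j + 1) - u j‖ / 2) • (u (j + 1) - u j) = 0)
    (hpsd : ∀ j < m, ∀ h, 0 ≤ ⟪H (u 0) h, h⟫_ℝ + M * ‖u (j + 1) - u j‖ / 2 * ‖h‖ ^ 2)
    (hc : 0 ≤ c) (hcurv : ∀ j < m, ∃ h, ⟪H (u (j + 1)) h, h⟫_ℝ < -c * ‖h‖ ^ 2) :
    m * c ^ 3 < 648 * M ^ 2 * (f (u 0) - f (u m)) := by
  set r : ℕ → ℝ := fun j => ‖u (j + 1) - u j‖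
  set S := ∑ j ∈ Finset.range m, r j with hS
  have hm₁ : (1 : ℝ) ≤ m := by exact_mod_cast hm
  have hm₀ : (0 : ℝ) < m := by linarith
  have r_nonneg : ∀ j, 0 ≤ r j := fun j => norm_nonneg _
  set a := S / m with ha
  have a_nonneg : 0 ≤ a := div_nonneg (Finset.sum_nonneg fun j _ => r_nonneg j) hm₀.le
  have LS : L * S = M / 6 * a := by rw [ha, hM]; field_simp
  have M_pos : 0 < M := by rw [hM]; positivity
  have L_le : L ≤ M / 6 := by rw [hM]; nlinarith
  have power_mean : m * a ^ 3 ≤ ∑ j ∈ Finset.range m, r j ^ 3 := by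
    have h := pow_sum_div_card_le_sum_pow (s := Finset.range m) (fun j _ => r_nonneg j) 2
    rw [Finset.card_range, ← hS] at h
    refine le_trans (le_of_eq ?_) h
    rw [ha]
    field_simp
  have step_bound : ∀ j ∈ Finset.range m,
      c ^ 3 < 648 * M ^ 2 * (f (u j) - f (u (j + 1))) + 20 * M ^ 3 * (a ^ 3 - r j ^ 3) := by
    intro j hj
    rw [Finset.mem_range] at hj
    have r_nonneg := r_nonneg j
    have decrease : M / 4 * r j ^ 3 - M / 12 * (a * r j ^ 2) - M / 18 * r j ^ 3
        ≤ f (u j) - f (u (j + 1)) := by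
      have h₁ := lazy_cubic_step_decrease hL.le hg hH hLip (hstep j hj) (hpsd j hj)
      have h₂ : L * ‖u j - u 0‖ * r j ^ 2 ≤ M / 6 * a * r j ^ 2 := by
        rw [← LS]
        gcongr
        exact norm_sub_le_sum_range_norm_sub u hj.le
      have h₃ : L * r j ^ 3 ≤ M / 6 * r j ^ 3 := by gcongr
      linarith
    have c_lt : c < M * (r j / 2 + a / 6) := by
      obtain ⟨h, hh⟩ := hcurv j hj
      have h₁ := lazy_cubic_step_curvature hLip (y := u (j + 1)) (hpsd j hj) h
      have h₂ : L * ‖u (j + 1) - u 0‖ ≤ M / 6 * a := by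
        rw [← LS]
        gcongr
        exact norm_sub_le_sum_range_norm_sub u hj
      have h₃ : c < M * r j / 2 + L * ‖u (j + 1) - u 0‖ := by
        refine lt_of_mul_lt_mul_right (a := ‖h‖ ^ 2) ?_ (by positivity)
        linarith
      linarith
    have c_cube : c ^ 3 < M ^ 3 * (r j / 2 + a / 6) ^ 3 := by
      rw [← mul_pow]
      exact pow_lt_pow_left₀ c_lt hc (by norm_num)
    have amgm : a * r j ^ 2 ≤ (a ^ 3 + 2 * r j ^ 3) / 3 := by
      nlinarith [mul_nonneg a_nonneg (sq_nonneg (a - r j)), mul_nonneg r_nonneg (sq_nonneg (a - r j))]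
    have cube : (r j / 2 + a / 6) ^ 3 ≤ 70 * r j ^ 3 + 2 * a ^ 3 := by
      have := add_pow_le (div_nonneg r_nonneg zero_le_two) (div_nonneg a_nonneg (by norm_num : (0 : ℝ) ≤ 6)) 3
      have := pow_nonneg r_nonneg 3
      have := pow_nonneg a_nonneg 3
      norm_num at *
      linarith
    have h₁ := mul_le_mul_of_nonneg_left decrease (by positivity : 0 ≤ 648 * M ^ 2)
    have h₂ := mul_le_mul_of_nonneg_left amgm (by positivity : 0 ≤ 54 * M ^ 3)
    have h₃ := mul_le_mul_of_nonneg_left cube (by positivity : 0 ≤ M ^ 3)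
    linarith
  have total := Finset.sum_lt_sum_of_nonempty (Finset.nonempty_range_iff.2 (by lia)) step_bound
  rw [Finset.sum_add_distrib, ← Finset.mul_sum, ← Finset.mul_sum, Finset.sum_range_sub',
    Finset.sum_sub_distrib] at total
  simp only [Finset.sum_const, Finset.card_range, nsmul_eq_mul] at total
  have := mul_le_mul_of_nonneg_left power_mean (by positivity : 0 ≤ 20 * M ^ 3)
  linarith

theorem lazy_cubic_min_eigenvalue_bound
    {E : Type*} [NormedAddCommGroup E] [InnerProductSpace ℝ E] [FiniteDimensional ℝ E]
    (f : E → ℝ) (g : E → E) (H : E → E →L[ℝ] E) (L : ℝ)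
    (hL : 0 < L) (hf : ContDiff ℝ 2 f)
    (hg : ∀ y, HasGradientAt f (g y) y)
    (hH : ∀ y, HasFDerivAt g (H y) y)
    (hsym : ∀ y u v, ⟪H y u, v⟫_ℝ = ⟪u, H y v⟫_ℝ)
    (hLip : ∀ y₁ y₂, ‖H y₁ - H y₂‖ ≤ L * ‖y₁ - y₂‖)
    (m : ℕ) (hm : 1 ≤ m) (M : ℝ) (hM : M = 6 * (m : ℝ) * L) (x : ℕ → E)
    (hstep : ∀ k : ℕ,
      g (x k) + H (x (k - k % m)) (x (k + 1) - x k)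
        + (M * ‖x (k + 1) - x k‖ / 2) • (x (k + 1) - x k) = 0)
    (hpsd : ∀ k : ℕ, ∀ h : E,
      0 ≤ ⟪H (x (k - k % m)) h, h⟫_ℝ + M * ‖x (k + 1) - x k‖ / 2 * ‖h‖ ^ 2)
    (fstar : ℝ) (hbelow : ∀ y, fstar ≤ f y)
    (t : ℕ) (ht : 1 ≤ t)
    :
    ∃ i : ℕ, 1 ≤ i ∧ i ≤ t * m ∧ ∀ h : E,
      ⟪H (x i) h, h⟫_ℝ ≥
        -((648 * M ^ 2 * (f (x 0) - fstar) / ((t * m : ℕ) : ℝ)) ^ ((1 : ℝ) / 3)) * ‖h‖ ^ 2 := by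
  by_contra! hcon
  have gap_nonneg : 0 ≤ f (x 0) - fstar := sub_nonneg.2 (hbelow _)
  set A := 648 * M ^ 2 * (f (x 0) - fstar) / ((t * m : ℕ) : ℝ) with hA
  have A_nonneg : 0 ≤ A := by positivity
  set c := A ^ ((1 : ℝ) / 3) with hc
  have c_nonneg : 0 ≤ c := Real.rpow_nonneg A_nonneg _
  have c_cube : c ^ 3 = A := by
    rw [hc, ← Real.rpow_natCast, ← Real.rpow_mul A_nonneg]
    norm_num
  have phase : ∀ p ∈ Finset.range t,
      m * c ^ 3 < 648 * M ^ 2 * (f (x (p * m)) - f (x ((p + 1) * m))) := by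
    intro p hp
    rw [Finset.mem_range] at hp
    have hpm : p * m + m ≤ t * m := by
      rw [← Nat.succ_mul]
      exact Nat.mul_le_mul_right m hp
    have start : ∀ j < m, p * m + j - (p * m + j) % m = p * m := by
      intro j hj
      rw [Nat.mul_add_mod_of_lt hj]
      lia
    rw [Nat.succ_mul]
    refine lazy_cubic_phase_decrease hL hg hH hLip hm hM (fun j => x (p * m + j)) ?_ ?_ c_nonneg ?_
    · intro j hj
      simpa only [start j hj, add_zero, add_assoc] using hstep (p * m + j)
    · intro j hj
      simpa only [start j hj, add_zero, add_assoc] using hpsd (p * m + j)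
    · intro j hj
      exact hcon (p * m + (j + 1)) (by lia) (by lia)
  have total := Finset.sum_lt_sum_of_nonempty (Finset.nonempty_range_iff.2 (by lia)) phase
  rw [Finset.sum_const, Finset.card_range, nsmul_eq_mul, ← Finset.mul_sum,
    Finset.sum_range_sub' (fun p => f (x (p * m))), zero_mul] at total
  have tm_pos : (0 : ℝ) < ((t * m : ℕ) : ℝ) := by
    exact_mod_cast Nat.mul_pos (by lia) (by lia)
  have scaled : ((t * m : ℕ) : ℝ) * A = 648 * M ^ 2 * (f (x 0) - fstar) := by
    rw [hA]
    field_simp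
  rw [c_cube, ← mul_assoc, ← Nat.cast_mul, scaled] at total
  have := mul_le_mul_of_nonneg_left (hbelow (x (t * m))) (by positivity : 0 ≤ 648 * M ^ 2)
  linarith
end

section
/- Assume f is convex and let M ≥ 3·L. Let x, z ∈ E with ∇f(x) ≠ 0, set λ := √(M·‖∇f(x)‖), and let x⁺ be the regularized lazy Newton step from x with Hessian snapshot z and regularization λ. Then ‖∇f(x⁺)‖ ≤ ( (7/6)·λ + L·‖z − x‖ ) · ‖x⁺ − x‖. -/
open scoped InnerProductSpace

/-- First-order Taylor remainder bound for a map with Lipschitz derivative. -/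
theorem norm_sub_sub_fderiv_le_of_lipschitz
    {E F : Type*} [NormedAddCommGroup E] [NormedSpace ℝ E]
    [NormedAddCommGroup F] [NormedSpace ℝ F]
    {g : E → F} {H : E → E →L[ℝ] F} {L : ℝ}
    (hH : ∀ y, HasFDerivAt g (H y) y)
    (hLip : ∀ y₁ y₂, ‖H y₁ - H y₂‖ ≤ L * ‖y₁ - y₂‖) (x d : E) :
    ‖g (x + d) - g x - H x d‖ ≤ L / 2 * ‖d‖ ^ 2 := by
  have hline (t : ℝ) : HasDerivAt (fun s : ℝ => x + s • d) d t := by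
    simpa using ((hasDerivAt_id t).smul_const d).const_add x
  have hrem (t : ℝ) : HasDerivAt (fun s : ℝ => g (x + s • d) - g x - s • H x d)
      (H (x + t • d) d - H x d) t := by
    have h := (hH (x + t • d)).comp_hasDerivAt t (hline t)
    exact ((h.sub_const (g x)).sub ((hasDerivAt_id t).smul_const (H x d))).congr_deriv (by simp)
  have hbound (t : ℝ) : HasDerivAt (fun s : ℝ => L / 2 * ‖d‖ ^ 2 * s ^ 2)
      (L * ‖d‖ ^ 2 * t) t := by
    refine ((hasDerivAt_pow 2 t).const_mul (L / 2 * ‖d‖ ^ 2)).congr_deriv ?_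
    norm_num
    ring
  have key := image_norm_le_of_norm_deriv_right_le_deriv_boundary (a := 0) (b := 1)
    (fun t _ => (hrem t).continuousAt.continuousWithinAt)
    (fun t _ => (hrem t).hasDerivWithinAt) (by simp) hbound
    (fun t ht => by
      calc ‖H (x + t • d) d - H x d‖ = ‖(H (x + t • d) - H x) d‖ := rfl
        _ ≤ ‖H (x + t • d) - H x‖ * ‖d‖ := ContinuousLinearMap.le_opNorm _ _
        _ ≤ (L * ‖x + t • d - x‖) * ‖d‖ := by gcongr; exact hLip _ _
        _ = L * ‖d‖ ^ 2 * t := by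
          rw [add_sub_cancel_left, norm_smul, Real.norm_of_nonneg ht.1]
          ring)
    (Set.right_mem_Icc.mpr zero_le_one)
  simpa using key

/-- A regularized step with a monotone linear operator is bounded by the gradient norm. -/
theorem mul_norm_le_of_add_add_smul_eq_zero
    {E : Type*} [NormedAddCommGroup E] [InnerProductSpace ℝ E]
    {A : E →L[ℝ] E} (hA : ∀ h, 0 ≤ ⟪A h, h⟫_ℝ) {v d : E} {lam : ℝ}
    (hstep : v + A d + lam • d = 0) : lam * ‖d‖ ≤ ‖v‖ := by
  rcases (norm_nonneg d).eq_or_lt with hd | hd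
  · simp [← hd]
  have h : ⟪v, d⟫_ℝ + ⟪A d, d⟫_ℝ + lam * ‖d‖ ^ 2 = 0 := by
    rw [← real_inner_self_eq_norm_sq, ← real_inner_smul_left, ← inner_add_left,
      ← inner_add_left, hstep, inner_zero_left]
  have hv := neg_le_of_abs_le (abs_real_inner_le_norm v d)
  refine le_of_mul_le_mul_right ?_ hd
  linarith [hA d]

theorem grad_reg_newton_grad_bound_convex
    {E : Type*} [NormedAddCommGroup E] [InnerProductSpace ℝ E] [FiniteDimensional ℝ E]
    (f : E → ℝ) (g : E → E) (H : E → E →L[ℝ] E) (L : ℝ)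
    (hL : 0 < L) (hf : ContDiff ℝ 2 f)
    (hg : ∀ y, HasGradientAt f (g y) y)
    (hH : ∀ y, HasFDerivAt g (H y) y)
    (hsym : ∀ y u v, ⟪H y u, v⟫_ℝ = ⟪u, H y v⟫_ℝ)
    (hLip : ∀ y₁ y₂, ‖H y₁ - H y₂‖ ≤ L * ‖y₁ - y₂‖)
    (hconv : ∀ y h, 0 ≤ ⟪H y h, h⟫_ℝ)
    (x z xp : E) (lam : ℝ)
    (hstep : g x + H z (xp - x) + lam • (xp - x) = 0)
    (M : ℝ) (hM : 3 * L ≤ M) (hgx : g x ≠ 0)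
    (hlam : lam = Real.sqrt (M * ‖g x‖)) :
    ‖g xp‖ ≤ (7 / 6 * lam + L * ‖z - x‖) * ‖xp - x‖ := by
  have hMpos : 0 < M := by linarith
  have hlampos : 0 < lam := by
    rw [hlam]
    exact Real.sqrt_pos.mpr (mul_pos hMpos (norm_pos_iff.mpr hgx))
  have hlamsq : lam ^ 2 = M * ‖g x‖ := by
    rw [hlam]
    exact Real.sq_sqrt (by positivity)
  set d := xp - x with hd
  have hshort : lam * ‖d‖ ≤ ‖g x‖ := mul_norm_le_of_add_add_smul_eq_zero (hconv z) hstep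
  have hMd : M * ‖d‖ ≤ lam := by
    refine le_of_mul_le_mul_left ?_ hlampos
    nlinarith
  have hLd : L / 2 * ‖d‖ ≤ lam / 6 := by
    nlinarith [norm_nonneg d]
  have htaylor := norm_sub_sub_fderiv_le_of_lipschitz hH hLip x d
  rw [show x + d = xp by simp [hd]] at htaylor
  have hsnap : ‖(H x - H z) d‖ ≤ L * ‖z - x‖ * ‖d‖ := by
    refine (ContinuousLinearMap.le_opNorm _ _).trans ?_
    rw [norm_sub_rev z x]
    gcongr
    exact hLip x z
  have hdecomp : g xp = (g xp - g x - H x d) + (H x - H z) d - lam • d := by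
    rw [sub_apply, ← sub_eq_zero, ← hstep]
    abel
  calc ‖g xp‖ = ‖(g xp - g x - H x d) + (H x - H z) d - lam • d‖ := by rw [← hdecomp]
    _ ≤ ‖g xp - g x - H x d‖ + ‖(H x - H z) d‖ + ‖lam • d‖ :=
      (norm_sub_le _ _).trans (by gcongr; exact norm_add_le _ _)
    _ ≤ L / 2 * ‖d‖ ^ 2 + L * ‖z - x‖ * ‖d‖ + lam * ‖d‖ := by
      rw [norm_smul, Real.norm_of_nonneg hlampos.le]
      gcongr
    _ ≤ (7 / 6 * lam + L * ‖z - x‖) * ‖d‖ := by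
      nlinarith [mul_le_mul_of_nonneg_right hLd (norm_nonneg d)]
end

section
/- Assume f is convex, bounded below by f⋆, let m ≥ 1 and M := 3·m·L. Let x_0, x_1, … be iterates with ∇f(x_k) ≠ 0 such that for every k ≥ 0, x_{k+1} is the regularized lazy Newton step from x_k with Hessian snapshot x_{π(k)} and regularization λ_k := √(M·‖∇f(x_k)‖), where π(k) := k − (k mod m). Let ε > 0, t ≥ 1, k := t·m, and assume ‖∇f(x_i)‖ ≥ ε for all 1 ≤ i ≤ k. Then f(x_0) − f⋆ ≥ (9·ε^{3/2}·k/(244·√M)) · ( 1 − (1/(2k))·ln( ‖∇f(x_0)‖/ε ) ). -/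
open scoped InnerProductSpace

/-- First-order Taylor bound for a map with Lipschitz derivative, the derivative being
evaluated at a point `z` at distance at most `s` from `x`. -/
theorem norm_sub_sub_le_of_lipschitz_fderiv
    {E F : Type*} [NormedAddCommGroup E] [NormedSpace ℝ E]
    [NormedAddCommGroup F] [NormedSpace ℝ F] {g : E → F} {H : E → E →L[ℝ] F} {L : ℝ}
    (hL : 0 ≤ L) (hH : ∀ y, HasFDerivAt g (H y) y)
    (hLip : ∀ y₁ y₂, ‖H y₁ - H y₂‖ ≤ L * ‖y₁ - y₂‖) {x z : E} {s : ℝ}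
    (hs : ‖x - z‖ ≤ s) (d : E) :
    ‖g (x + d) - g x - H z d‖ ≤ L * ‖d‖ * (s + ‖d‖ / 2) := by
  have hderiv : ∀ t : ℝ, HasDerivAt (fun t : ℝ => g (x + t • d) - g x - t • H z d)
      (H (x + t • d) d - H z d) t := by
    intro t
    have hline : HasDerivAt (fun t : ℝ => x + t • d) d t := by
      simpa using ((hasDerivAt_id t).smul_const d).const_add x
    have hlin : HasDerivAt (fun t : ℝ => t • H z d) (H z d) t := by
      simpa using (hasDerivAt_id t).smul_const (H z d)
    exact (((hH (x + t • d)).comp_hasDerivAt t hline).sub_const (g x)).sub hlin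
  have hB : ∀ t : ℝ, HasDerivAt (fun t : ℝ => L * ‖d‖ * (s * t + ‖d‖ / 2 * t ^ 2))
      (L * ‖d‖ * (s + ‖d‖ * t)) t := by
    intro t
    refine ((((hasDerivAt_id t).const_mul s).add
      (((hasDerivAt_id t).pow 2).const_mul (‖d‖ / 2))).const_mul (L * ‖d‖)).congr_deriv ?_
    simp only [id, Nat.cast_ofNat]
    ring
  have key := image_norm_le_of_norm_deriv_right_le_deriv_boundary (a := 0) (b := 1)
    (fun t _ => (hderiv t).continuousAt.continuousWithinAt)
    (fun t _ => (hderiv t).hasDerivWithinAt) (by simp) hB ?_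
    (Set.right_mem_Icc.2 zero_le_one)
  · simpa using key
  · intro t ht
    have hdist : ‖x + t • d - z‖ ≤ s + ‖d‖ * t := calc
      ‖x + t • d - z‖ = ‖(x - z) + t • d‖ := by congr 1; abel
      _ ≤ ‖x - z‖ + ‖t • d‖ := norm_add_le _ _
      _ ≤ s + ‖d‖ * t := by
        rw [norm_smul, Real.norm_of_nonneg ht.1, mul_comm t]
        gcongr
    calc ‖H (x + t • d) d - H z d‖ = ‖(H (x + t • d) - H z) d‖ := by simp
      _ ≤ ‖H (x + t • d) - H z‖ * ‖d‖ := ContinuousLinearMap.le_opNorm _ _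
      _ ≤ L * (s + ‖d‖ * t) * ‖d‖ := by
        gcongr
        exact (hLip _ _).trans (by gcongr)
      _ = L * ‖d‖ * (s + ‖d‖ * t) := by ring

/-- The gradient inequality for a function with positive semidefinite Hessian. -/
theorem inner_gradient_le_sub_of_hessian_nonneg
    {E : Type*} [NormedAddCommGroup E] [InnerProductSpace ℝ E] [CompleteSpace E]
    {f : E → ℝ} {g : E → E} {H : E → E →L[ℝ] E}
    (hg : ∀ y, HasGradientAt f (g y) y) (hH : ∀ y, HasFDerivAt g (H y) y)
    (hconv : ∀ y h, 0 ≤ ⟪H y h, h⟫_ℝ) (y v : E) :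
    ⟪g y, v⟫_ℝ ≤ f (y + v) - f y := by
  have hline : ∀ t : ℝ, HasDerivAt (fun t : ℝ => y + t • v) v t := fun t => by
    simpa using ((hasDerivAt_id t).smul_const v).const_add y
  have hslope : ∀ t : ℝ, HasDerivAt (fun t : ℝ => ⟪g (y + t • v), v⟫_ℝ)
      ⟪H (y + t • v) v, v⟫_ℝ t := fun t => by
    simpa using ((hH (y + t • v)).comp_hasDerivAt t (hline t)).inner ℝ (hasDerivAt_const t v)
  have hmono : Monotone (fun t : ℝ => ⟪g (y + t • v), v⟫_ℝ) :=
    monotone_of_deriv_nonneg (fun t => (hslope t).differentiableAt) fun t => by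
      rw [(hslope t).deriv]
      exact hconv _ _
  have hval : ∀ t : ℝ, HasDerivAt (fun t : ℝ => f (y + t • v)) ⟪g (y + t • v), v⟫_ℝ t :=
    fun t => by
      have := (hg (y + t • v)).hasFDerivAt.comp_hasDerivAt t (hline t)
      rwa [InnerProductSpace.toDual_apply_apply] at this
  obtain ⟨c, hc, hceq⟩ := exists_hasDerivAt_eq_slope (fun t : ℝ => f (y + t • v))
    (fun t : ℝ => ⟪g (y + t • v), v⟫_ℝ) zero_lt_one
    (fun t _ => (hval t).continuousAt.continuousWithinAt) fun t _ => hval t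
  have h0 := hmono hc.1.le
  simp only [zero_smul, add_zero, one_smul, sub_zero, div_one] at hceq h0
  exact h0.trans hceq.le

/-- Length of a regularized Newton step with positive semidefinite matrix. -/
theorem mul_norm_le_of_regularized_step
    {E : Type*} [NormedAddCommGroup E] [InnerProductSpace ℝ E] {A : E →L[ℝ] E}
    (hA : ∀ h, 0 ≤ ⟪A h, h⟫_ℝ) {u d : E} {l : ℝ} (hstep : u + A d + l • d = 0) :
    l * ‖d‖ ≤ ‖u‖ := by
  rcases eq_or_ne d 0 with rfl | hd
  · simp
  have h0 : ⟪u, d⟫_ℝ + ⟪A d, d⟫_ℝ + l * ‖d‖ ^ 2 = 0 := by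
    rw [← real_inner_self_eq_norm_sq, ← real_inner_smul_left, ← inner_add_left,
      ← inner_add_left, hstep, inner_zero_left]
  have h1 : -⟪u, d⟫_ℝ ≤ ‖u‖ * ‖d‖ := (neg_le_abs _).trans (abs_real_inner_le_norm u d)
  have h2 := hA d
  exact le_of_mul_le_mul_right (by nlinarith) (norm_pos_iff.2 hd)

/-- Progress of one regularized lazy Newton step in the objective; the error term caused by the
outdated Hessian telescopes along a phase. -/
theorem lazy_newton_step_decrease
    {E : Type*} [NormedAddCommGroup E] [InnerProductSpace ℝ E] [CompleteSpace E]
    {f : E → ℝ} {g : E → E} {H : E → E →L[ℝ] E} {L M : ℝ} (hL : 0 ≤ L) (hM : 0 < M)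
    (hg : ∀ y, HasGradientAt f (g y) y) (hH : ∀ y, HasFDerivAt g (H y) y)
    (hLip : ∀ y₁ y₂, ‖H y₁ - H y₂‖ ≤ L * ‖y₁ - y₂‖)
    (hconv : ∀ y h, 0 ≤ ⟪H y h, h⟫_ℝ) {x z d : E} {s : ℝ} (hs : ‖x - z‖ ≤ s)
    (hx : g x ≠ 0) (hstep : g x + H z d + √(M * ‖g x‖) • d = 0) :
    ‖g (x + d)‖ ^ 2 / (2 * √(M * ‖g x‖)) + M / 2 * ‖d‖ ^ 3
      - L ^ 2 / (6 * M) * ((s + ‖d‖) ^ 3 - s ^ 3) ≤ f x - f (x + d) := by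
  have hpos : 0 < M * ‖g x‖ := mul_pos hM (norm_pos_iff.2 hx)
  have hlen := mul_norm_le_of_regularized_step (hconv z) hstep
  have hsq : √(M * ‖g x‖) ^ 2 = M * ‖g x‖ := Real.sq_sqrt hpos.le
  have hl : 0 < √(M * ‖g x‖) := Real.sqrt_pos.2 hpos
  have hT := norm_sub_sub_le_of_lipschitz_fderiv hL hH hLip hs d
  have hres : g (x + d) - g x - H z d = g (x + d) + √(M * ‖g x‖) • d := by
    rw [← sub_eq_zero, ← neg_eq_zero, ← hstep]
    abel
  have hgrad := inner_gradient_le_sub_of_hessian_nonneg hg hH hconv (x + d) (-d)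
  rw [add_neg_cancel_right, inner_neg_right] at hgrad
  rw [hres] at hT
  have hT2 := pow_le_pow_left₀ (norm_nonneg _) hT 2
  rw [norm_add_sq_real, real_inner_smul_right, norm_smul, Real.norm_of_nonneg hl.le] at hT2
  have hs0 : 0 ≤ s := (norm_nonneg _).trans hs
  have hr : 0 ≤ ‖d‖ := norm_nonneg d
  set l := √(M * ‖g x‖)
  set r := ‖d‖
  have hMr : M * r ≤ l := le_of_mul_le_mul_right (by nlinarith) hl
  have hrl : r / l ≤ 1 / M := by
    rw [div_le_div_iff₀ hl hM]
    linarith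
  have herr : L ^ 2 / 2 * (r * (s + r / 2) ^ 2) * (r / l)
      ≤ L ^ 2 / (6 * M) * ((s + r) ^ 3 - s ^ 3) := calc
    L ^ 2 / 2 * (r * (s + r / 2) ^ 2) * (r / l)
      ≤ L ^ 2 / 2 * (((s + r) ^ 3 - s ^ 3) / 3) * (1 / M) := by
        have : r * (s + r / 2) ^ 2 ≤ ((s + r) ^ 3 - s ^ 3) / 3 := by
          nlinarith [pow_nonneg hr 3]
        have hcubes : 0 ≤ ((s + r) ^ 3 - s ^ 3) / 3 := le_trans (by positivity) this
        gcongr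
    _ = L ^ 2 / (6 * M) * ((s + r) ^ 3 - s ^ 3) := by
        field_simp
        ring
  have hcube : M / 2 * r ^ 3 ≤ l / 2 * r ^ 2 := by nlinarith [sq_nonneg r]
  have hdiv : ‖g (x + d)‖ ^ 2 / (2 * l) + l / 2 * r ^ 2
      - L ^ 2 / 2 * (r * (s + r / 2) ^ 2) * (r / l) ≤ -⟪g (x + d), d⟫_ℝ := by
    have : ‖g (x + d)‖ ^ 2 / (2 * l) + l / 2 * r ^ 2
        - L ^ 2 / 2 * (r * (s + r / 2) ^ 2) * (r / l)
        = (‖g (x + d)‖ ^ 2 + l ^ 2 * r ^ 2 - (L * r * (s + r / 2)) ^ 2) / (2 * l) := by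
      field_simp
    rw [this, div_le_iff₀ (by positivity)]
    linarith
  linarith

/-- Progress along a whole phase of at most `m` lazy steps sharing the snapshot `x 0`, provided
that the regularization constant is at least `m * L / √3`. -/
theorem lazy_newton_phase_decrease
    {E : Type*} [NormedAddCommGroup E] [InnerProductSpace ℝ E] [CompleteSpace E]
    {f : E → ℝ} {g : E → E} {H : E → E →L[ℝ] E} {L M : ℝ} (hL : 0 ≤ L) (hM : 0 < M)
    (hg : ∀ y, HasGradientAt f (g y) y) (hH : ∀ y, HasFDerivAt g (H y) y)
    (hLip : ∀ y₁ y₂, ‖H y₁ - H y₂‖ ≤ L * ‖y₁ - y₂‖)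
    (hconv : ∀ y h, 0 ≤ ⟪H y h, h⟫_ℝ) {m : ℕ} (hLM : (m * L) ^ 2 ≤ 3 * M ^ 2) {x : ℕ → E}
    (hx : ∀ k, g (x k) ≠ 0)
    (hstep : ∀ k < m, g (x k) + H (x 0) (x (k + 1) - x k)
      + √(M * ‖g (x k)‖) • (x (k + 1) - x k) = 0) :
    ∑ i ∈ Finset.range m, ‖g (x (i + 1))‖ ^ 2 / (2 * √(M * ‖g (x i)‖)) ≤ f (x 0) - f (x m) := by
  have partial_bound : ∀ n ≤ m,
      ∑ i ∈ Finset.range n, ‖g (x (i + 1))‖ ^ 2 / (2 * √(M * ‖g (x i)‖))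
        + M / 2 * ∑ i ∈ Finset.range n, ‖x (i + 1) - x i‖ ^ 3
        - L ^ 2 / (6 * M) * (∑ i ∈ Finset.range n, ‖x (i + 1) - x i‖) ^ 3
        ≤ f (x 0) - f (x n) := by
    intro n
    induction n with
    | zero => simp
    | succ n ih =>
      intro hn
      have hdist : ‖x n - x 0‖ ≤ ∑ i ∈ Finset.range n, ‖x (i + 1) - x i‖ := by
        rw [← Finset.sum_range_sub]
        exact norm_sum_le _ _
      have hdec := lazy_newton_step_decrease hL hM hg hH hLip hconv hdist (hx n) (hstep n hn)
      rw [add_sub_cancel] at hdec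
      simp only [Finset.sum_range_succ]
      linarith [ih (by lia)]
  have hpow : (∑ i ∈ Finset.range m, ‖x (i + 1) - x i‖) ^ 3
      ≤ (m : ℝ) ^ 2 * ∑ i ∈ Finset.range m, ‖x (i + 1) - x i‖ ^ 3 := by
    rcases m.eq_zero_or_pos with rfl | hm
    · simp
    have hmean := pow_sum_div_card_le_sum_pow (s := Finset.range m)
      (f := fun i => ‖x (i + 1) - x i‖) (fun i _ => norm_nonneg _) 2
    rwa [Finset.card_range, div_le_iff₀' (by positivity)] at hmean
  have hcoef : L ^ 2 / (6 * M) * (m : ℝ) ^ 2 ≤ M / 2 := by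
    rw [div_mul_eq_mul_div, div_le_div_iff₀ (by positivity) two_pos]
    nlinarith
  have herr : L ^ 2 / (6 * M) * (∑ i ∈ Finset.range m, ‖x (i + 1) - x i‖) ^ 3
      ≤ M / 2 * ∑ i ∈ Finset.range m, ‖x (i + 1) - x i‖ ^ 3 := calc
    _ ≤ L ^ 2 / (6 * M) * ((m : ℝ) ^ 2 * ∑ i ∈ Finset.range m, ‖x (i + 1) - x i‖ ^ 3) := by
      gcongr
    _ = L ^ 2 / (6 * M) * (m : ℝ) ^ 2 * ∑ i ∈ Finset.range m, ‖x (i + 1) - x i‖ ^ 3 := by ring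
    _ ≤ _ := by gcongr
  linarith [partial_bound m le_rfl]

/-- Lower bound on the progress term by the accuracy and a telescoping logarithm. -/
theorem rpow_mul_one_add_log_le {a b ε : ℝ} (ha : 0 < a) (hε : 0 < ε) (hb : ε ≤ b) {M : ℝ}
    (hM : 0 < M) :
    ε ^ (3 / 2 : ℝ) / (2 * √M) * (1 + (Real.log b - Real.log a) / 2)
      ≤ b ^ 2 / (2 * √(M * a)) := by
  have hb0 : 0 < b := hε.trans_le hb
  have hratio : 1 + (Real.log b - Real.log a) / 2 ≤ √b / √a := by
    have := Real.log_le_sub_one_of_pos (x := √b / √a) (by positivity)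
    rw [Real.log_div (by positivity) (by positivity), Real.log_sqrt hb0.le,
      Real.log_sqrt ha.le] at this
    linarith
  have hsplit : b ^ 2 = b ^ (3 / 2 : ℝ) * √b := by
    rw [Real.sqrt_eq_rpow, ← Real.rpow_add hb0, ← Real.rpow_natCast]
    norm_num
  calc ε ^ (3 / 2 : ℝ) / (2 * √M) * (1 + (Real.log b - Real.log a) / 2)
      ≤ ε ^ (3 / 2 : ℝ) / (2 * √M) * (√b / √a) := by gcongr
    _ ≤ b ^ (3 / 2 : ℝ) / (2 * √M) * (√b / √a) := by gcongr
    _ = b ^ 2 / (2 * √(M * a)) := by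
      rw [hsplit, Real.sqrt_mul hM.le]
      field_simp

theorem grad_reg_newton_global_complexity
    {E : Type*} [NormedAddCommGroup E] [InnerProductSpace ℝ E] [FiniteDimensional ℝ E]
    (f : E → ℝ) (g : E → E) (H : E → E →L[ℝ] E) (L : ℝ)
    (hL : 0 < L) (hf : ContDiff ℝ 2 f)
    (hg : ∀ y, HasGradientAt f (g y) y)
    (hH : ∀ y, HasFDerivAt g (H y) y)
    (hsym : ∀ y u v, ⟪H y u, v⟫_ℝ = ⟪u, H y v⟫_ℝ)
    (hLip : ∀ y₁ y₂, ‖H y₁ - H y₂‖ ≤ L * ‖y₁ - y₂‖)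
    (hconv : ∀ y h, 0 ≤ ⟪H y h, h⟫_ℝ)
    (m : ℕ) (hm : 1 ≤ m) (M : ℝ) (hM : M = 3 * (m : ℝ) * L) (x : ℕ → E)
    (fstar : ℝ) (hbelow : ∀ y, fstar ≤ f y)
    (hgnz : ∀ k : ℕ, g (x k) ≠ 0)
    (hstep : ∀ k : ℕ,
      g (x k) + H (x (k - k % m)) (x (k + 1) - x k)
        + Real.sqrt (M * ‖g (x k)‖) • (x (k + 1) - x k) = 0)
    (ε : ℝ) (hε : 0 < ε) (t : ℕ) (ht : 1 ≤ t)
    (hgrad : ∀ i, 1 ≤ i → i ≤ t * m → ε ≤ ‖g (x i)‖) :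
    f (x 0) - fstar ≥
      9 * ε ^ ((3 : ℝ) / 2) * ((t * m : ℕ) : ℝ) / (244 * Real.sqrt M) *
        (1 - 1 / (2 * ((t * m : ℕ) : ℝ)) * Real.log (‖g (x 0)‖ / ε)) := by
  have hm0 : (0 : ℝ) < m := by exact_mod_cast hm
  have hM0 : 0 < M := by rw [hM]; positivity
  have hLM : (m * L) ^ 2 ≤ 3 * M ^ 2 := by rw [hM]; nlinarith [sq_nonneg (m * L)]
  have hphase : ∀ q : ℕ, ∑ i ∈ Finset.range (q * m),
      ‖g (x (i + 1))‖ ^ 2 / (2 * √(M * ‖g (x i)‖)) ≤ f (x 0) - f (x (q * m)) := by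
    intro q
    induction q with
    | zero => simp
    | succ q ih =>
      have hdec := lazy_newton_phase_decrease (x := fun i => x (q * m + i)) hL.le hM0 hg hH hLip
        hconv hLM (fun k => hgnz _) fun k hk => by
          have hmod : q * m + k - (q * m + k) % m = q * m + 0 := by
            rw [Nat.mul_add_mod_of_lt hk]
            lia
          have := hstep (q * m + k)
          rwa [hmod] at this
      rw [add_one_mul, Finset.sum_range_add]
      simp only [add_zero, ← add_assoc] at hdec
      linarith
  set k := t * m
  have hk : 1 ≤ k := Nat.mul_pos ht hm
  have hk0 : (0 : ℝ) < k := by exact_mod_cast hk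
  have hsum : ε ^ (3 / 2 : ℝ) / (2 * √M)
      * (k + (Real.log ‖g (x k)‖ - Real.log ‖g (x 0)‖) / 2) ≤ f (x 0) - fstar := calc
    _ = ∑ i ∈ Finset.range k, ε ^ (3 / 2 : ℝ) / (2 * √M)
          * (1 + (Real.log ‖g (x (i + 1))‖ - Real.log ‖g (x i)‖) / 2) := by
      rw [← Finset.mul_sum, Finset.sum_add_distrib, ← Finset.sum_div,
        Finset.sum_range_sub (fun i => Real.log ‖g (x i)‖)]
      simp
    _ ≤ _ := Finset.sum_le_sum fun i hi => rpow_mul_one_add_log_le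
      (norm_pos_iff.2 (hgnz i)) hε
      (hgrad (i + 1) (by lia) (Finset.mem_range.1 hi)) hM0
    _ ≤ f (x 0) - f (x k) := hphase t
    _ ≤ f (x 0) - fstar := by gcongr; exact hbelow _
  have hlog : Real.log ε ≤ Real.log ‖g (x k)‖ := Real.log_le_log hε (hgrad k hk le_rfl)
  have hbracket : (k : ℝ) * (1 - 1 / (2 * k) * Real.log (‖g (x 0)‖ / ε))
      = k + (Real.log ε - Real.log ‖g (x 0)‖) / 2 := by
    rw [Real.log_div (norm_ne_zero_iff.2 (hgnz 0)) hε.ne']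
    field_simp
    ring
  have hC : 0 ≤ ε ^ (3 / 2 : ℝ) / (2 * √M) := by positivity
  have hfull : ε ^ (3 / 2 : ℝ) / (2 * √M)
      * (k * (1 - 1 / (2 * k) * Real.log (‖g (x 0)‖ / ε))) ≤ f (x 0) - fstar := by
    rw [hbracket]
    refine le_trans ?_ hsum
    gcongr
  have hscale : 9 * ε ^ ((3 : ℝ) / 2) * (k : ℝ) / (244 * √M)
        * (1 - 1 / (2 * k) * Real.log (‖g (x 0)‖ / ε))
      = 9 / 122 * (ε ^ (3 / 2 : ℝ) / (2 * √M)
        * (k * (1 - 1 / (2 * k) * Real.log (‖g (x 0)‖ / ε)))) := by ring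
  rw [ge_iff_le, hscale]
  linarith [hbelow (x 0)]
end
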